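/- Let X be a set, k : X → X → ℂ a PSD kernel, and z ∈ X with k(z,z) ≠ 0. Let s, t ∈ ℕ and Φ : X → Matrix (Fin s) (Fin t) ℂ be such that the kernel (1 − Φ Φ*) k is PSD, i.e., for every n ∈ ℕ and tuple x : Fin n → X the block matrix indexed by Fin n × Fin s with ((i,a),(j,b)) entry k (x i) (x j) * ((1 : Matrix (Fin s) (Fin s) ℂ) − Φ (x i) * (Φ (x j))ᴴ) a b is positive semidefinite. Define k^z(x,y) := k(x,y) − k(x,z) * k(z,y) / k(z,z). Then the kernel (1 − Φ Φ*) k^z is PSD in the same sense: for every n and every tuple x : Fin n → X the block matrix with ((i,a),(j,b)) entry k^z (x i) (x j) * ((1 : Matrix (Fin s) (Fin s) ℂ) − Φ (x i) * (Φ (x j))ᴴ) a b is positive semidefinite. -/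

import Mathlib

open ComplexOrder Matrix

/-- A kernel `k : X → X → ℂ` is positive semidefinite if for every finite tuple of points the
associated Gram-type matrix is positive semidefinite. -/
def IsPSDKernel {X : Type*} (k : X → X → ℂ) : Prop :=
  ∀ (n : ℕ) (x : Fin n → X), (Matrix.of fun i j : Fin n => k (x i) (x j)).PosSemidef

/-- Given `Φ : X → Matrix (Fin s) (Fin t) ℂ`, the operator-valued kernel `(1 - Φ Φ*) k` is PSD:
for every tuple `x : Fin n → X`, the block matrix with `((i,a),(j,b))` entry
`k (x i) (x j) * ((1 - Φ (x i) * (Φ (x j))ᴴ) a b)` is positive semidefinite. -/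
def MultKernelPSD {X : Type*} (k : X → X → ℂ) {s t : ℕ}
    (Φ : X → Matrix (Fin s) (Fin t) ℂ) : Prop :=
  ∀ (n : ℕ) (x : Fin n → X),
    (Matrix.of fun p q : Fin n × Fin s =>
      k (x p.1) (x q.1) *
        ((1 : Matrix (Fin s) (Fin s) ℂ) - Φ (x p.1) * (Φ (x q.1))ᴴ) p.2 q.2).PosSemidef

namespace IsPSDKernel

variable {X : Type*} {k : X → X → ℂ}

theorem star_apply (hk : IsPSDKernel k) (x y : X) : star (k x y) = k y x := by
  simpa using (hk 2 ![y, x]).isHermitian.apply 0 1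

theorem apply_self_nonneg (hk : IsPSDKernel k) (x : X) : 0 ≤ k x x := by
  simpa using (hk 1 ![x]).diag_nonneg (i := 0)

end IsPSDKernel

/-- The matrix sending a coefficient vector at the points `x` to the one at the points
`Fin.cons z x` for which the corresponding combination of kernel functions vanishes at `z`. -/
noncomputable def kernelVanishingMatrix {X : Type*} (k : X → X → ℂ) (z : X) (s : ℕ) {n : ℕ}
    (x : Fin n → X) : Matrix (Fin (n + 1) × Fin s) (Fin n × Fin s) ℂ :=
  Matrix.of fun p q => if p.2 = q.2 then
    (Fin.cons (-(k z (x q.1) / k z z)) (Pi.single q.1 1) : Fin (n + 1) → ℂ) p.1 else 0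

theorem mul_kernelVanishingMatrix_apply {X : Type*} (k : X → X → ℂ) (z : X) {s n : ℕ}
    (x : Fin n → X) {m : Type*} (A : Matrix m (Fin (n + 1) × Fin s) ℂ) (p : m)
    (q : Fin n × Fin s) :
    (A * kernelVanishingMatrix k z s x) p q =
      A p (q.1.succ, q.2) - A p (0, q.2) * (k z (x q.1) / k z z) := by
  simp [kernelVanishingMatrix, Matrix.mul_apply, Fintype.sum_prod_type, Fin.sum_univ_succ,
    Pi.single_apply]
  ring

theorem conjTranspose_kernelVanishingMatrix_mul_apply {X : Type*} {k : X → X → ℂ}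
    (hk : IsPSDKernel k) (z : X) {s n : ℕ} (x : Fin n → X) {m : Type*}
    (A : Matrix (Fin (n + 1) × Fin s) m ℂ) (p : Fin n × Fin s) (q : m) :
    ((kernelVanishingMatrix k z s x)ᴴ * A) p q =
      A (p.1.succ, p.2) q - k (x p.1) z / k z z * A (0, p.2) q := by
  have h := congrArg star (mul_kernelVanishingMatrix_apply k z x Aᴴ q p)
  rw [← Matrix.conjTranspose_apply, Matrix.conjTranspose_mul,
    Matrix.conjTranspose_conjTranspose] at h
  rw [h]
  simp only [star_sub, star_mul', star_div₀, hk.star_apply, Matrix.conjTranspose_apply, star_star]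
  ring

/-- If `k` is a PSD kernel, `k(z,z) ≠ 0`, and the operator-valued kernel `(1 - Φ Φ*) k` is PSD,
then `(1 - Φ Φ*) k^z` is also PSD, where `k^z(x,y) = k(x,y) - k(x,z) k(z,y) / k(z,z)`. -/
theorem multKernelPSD_compression {X : Type*} (k : X → X → ℂ)
    (hpsd : IsPSDKernel k) (z : X) (hz : k z z ≠ 0)
    (s t : ℕ) (Φ : X → Matrix (Fin s) (Fin t) ℂ)
    (hΦ : MultKernelPSD k Φ) :
    MultKernelPSD (fun x y => k x y - k x z * k z y / k z z) Φ := by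
  intro n x
  have hcompr := (hΦ (n + 1) (Fin.cons z x)).conjTranspose_mul_mul_same
    (kernelVanishingMatrix k z s x)
  let W : Matrix (Fin n × Fin s) (Fin t) ℂ :=
    Matrix.of fun p b => k (x p.1) z * (Φ (x p.1) - Φ z) p.2 b
  have hgram : ((k z z)⁻¹ • (W * Wᴴ)).PosSemidef :=
    (Matrix.posSemidef_self_mul_conjTranspose W).smul
      (inv_nonneg.mpr (hpsd.apply_self_nonneg z))
  convert hcompr.add hgram using 1
  ext p q
  have hW : (W * Wᴴ) p q = k (x p.1) z * k z (x q.1) *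
      ((Φ (x p.1) - Φ z) * (Φ (x q.1) - Φ z)ᴴ) p.2 q.2 := by
    simp only [W, Matrix.mul_apply, Matrix.conjTranspose_apply, Matrix.of_apply, star_mul',
      hpsd.star_apply, Finset.mul_sum]
    exact Finset.sum_congr rfl fun _ _ => by ring
  rw [Matrix.add_apply, mul_kernelVanishingMatrix_apply,
    conjTranspose_kernelVanishingMatrix_mul_apply hpsd,
    conjTranspose_kernelVanishingMatrix_mul_apply hpsd, Matrix.smul_apply, hW]
  simp only [Matrix.of_apply, Fin.cons_succ, Fin.cons_zero, Matrix.conjTranspose_sub,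
    Matrix.sub_mul, Matrix.mul_sub, Matrix.sub_apply, smul_eq_mul]
  field_simp
  ring
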